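/- Let R(q) = (q,q^4;q^5)_∞/(q^2,q^3;q^5)_∞ and E(q)=(q;q)_∞. Then R(q^2)/R(q)^2 - R(q)^2/R(q^2) = 4q E(q) E(q^{10})^5/(E(q^2) E(q^5)^5). -/

import Mathlib

/-- Euler's product E(q) = ∏_{k≥0} (1 - q^{k+1}). -/
noncomputable def E (q : ℂ) : ℂ := ∏' k : ℕ, (1 - q ^ (k + 1))

/-- q-Pochhammer infinite product (a;q)_∞ = ∏_{k≥0} (1 - a q^k). -/
noncomputable def qp (a q : ℂ) : ℂ := ∏' k : ℕ, (1 - a * q ^ k)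

/-- Rogers–Ramanujan function G(q) = 1/((q,q^4;q^5)_∞). -/
noncomputable def G (q : ℂ) : ℂ := 1 / (qp q (q ^ 5) * qp (q ^ 4) (q ^ 5))

/-- Rogers–Ramanujan function H(q) = 1/((q^2,q^3;q^5)_∞). -/
noncomputable def H (q : ℂ) : ℂ := 1 / (qp (q ^ 2) (q ^ 5) * qp (q ^ 3) (q ^ 5))

/-- Rogers–Ramanujan continued fraction product R(q). -/
noncomputable def R (q : ℂ) : ℂ :=
  (qp q (q ^ 5) * qp (q ^ 4) (q ^ 5)) / (qp (q ^ 2) (q ^ 5) * qp (q ^ 3) (q ^ 5))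

open Filter Topology

/-- The two-sided theta series `∑ r ^ (n (n - 1)) z ^ n`. -/
noncomputable def thetaSeries (r z : ℂ) : ℂ := ∑' n : ℤ, r ^ (n * (n - 1)) * z ^ n

theorem summable_norm_mul_pow {q : ℂ} (hq : ‖q‖ < 1) (a : ℂ) :
    Summable fun k : ℕ => ‖-(a * q ^ k)‖ := by
  simp only [norm_neg, norm_mul, norm_pow]
  exact (summable_geometric_of_lt_one (norm_nonneg _) hq).mul_left _

theorem multipliable_qp {q : ℂ} (hq : ‖q‖ < 1) (a : ℂ) :
    Multipliable fun k : ℕ => 1 - a * q ^ k := by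
  simpa only [sub_eq_add_neg] using multipliable_one_add_of_summable (summable_norm_mul_pow hq a)

theorem tendsto_qp {q : ℂ} (hq : ‖q‖ < 1) (a : ℂ) :
    Tendsto (fun n => ∏ k ∈ Finset.range n, (1 - a * q ^ k)) atTop (𝓝 (qp a q)) :=
  (multipliable_qp hq a).tendsto_prod_tprod_nat

theorem qp_ne_zero {q : ℂ} (hq : ‖q‖ < 1) {a : ℂ} (ha : ‖a‖ < 1) : qp a q ≠ 0 := by
  have h := tprod_one_add_ne_zero_of_summable (f := fun k : ℕ => -(a * q ^ k)) ?_
    (summable_norm_mul_pow hq a)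
  · simpa only [qp, sub_eq_add_neg] using h
  · intro k hk
    have h1 : a * q ^ k = 1 := by linear_combination -hk
    have h2 : ‖a * q ^ k‖ < 1 := by
      rw [norm_mul, norm_pow]
      exact mul_lt_one_of_nonneg_of_lt_one_left (norm_nonneg _) ha
        (pow_le_one₀ (norm_nonneg _) hq.le)
    rw [h1, norm_one] at h2
    exact lt_irrefl _ h2

theorem E_eq_qp (q : ℂ) : E q = qp q q := by
  simp_rw [E, qp, pow_succ']

theorem qp_eq_prod {q : ℂ} (hq : ‖q‖ < 1) (a : ℂ) {m : ℕ} (hm : 0 < m) :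
    qp a q = ∏ i ∈ Finset.range m, qp (a * q ^ i) (q ^ m) := by
  have hqm : ‖q ^ m‖ < 1 := by
    rw [norm_pow]; exact pow_lt_one₀ (norm_nonneg _) hq hm.ne'
  refine tendsto_nhds_unique
    ((tendsto_qp hq a).comp (tendsto_id.const_mul_atTop' hm)) ?_
  refine (tendsto_finsetProd _ fun i _ => tendsto_qp hqm (a * q ^ i)).congr fun n => ?_
  simp only [Function.comp_apply, id]
  induction n with
  | zero => simp
  | succ n ih =>
    rw [Nat.mul_succ, Finset.prod_range_add, ← ih, ← Finset.prod_mul_distrib]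
    refine Finset.prod_congr rfl fun i _ => ?_
    rw [Finset.prod_range_succ, pow_add, pow_mul]
    ring

/-- The finite product `∏_{k < n} (1 - p ^ (k + 1))`. -/
noncomputable def qFac (p : ℂ) (n : ℕ) : ℂ := ∏ k ∈ Finset.range n, (1 - p * p ^ k)

theorem one_sub_mul_pow_ne_zero {p : ℂ} (hp : ‖p‖ < 1) (k : ℕ) : 1 - p * p ^ k ≠ 0 := by
  intro h
  have h1 : p ^ (k + 1) = 1 := by rw [pow_succ']; linear_combination -h
  have h2 : ‖p ^ (k + 1)‖ < 1 := by
    rw [norm_pow]; exact pow_lt_one₀ (norm_nonneg _) hp k.succ_ne_zero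
  rw [h1, norm_one] at h2
  exact lt_irrefl _ h2

theorem qFac_ne_zero {p : ℂ} (hp : ‖p‖ < 1) (n : ℕ) : qFac p n ≠ 0 :=
  Finset.prod_ne_zero_iff.2 fun k _ => one_sub_mul_pow_ne_zero hp k

theorem qFac_succ (p : ℂ) (n : ℕ) : qFac p (n + 1) = qFac p n * (1 - p * p ^ n) :=
  Finset.prod_range_succ _ _

/-- The Gaussian binomial coefficient, with value zero for `n < j`. -/
noncomputable def gaussBinom (p : ℂ) (n j : ℕ) : ℂ :=
  if j ≤ n then qFac p n / (qFac p j * qFac p (n - j)) else 0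

theorem gaussBinom_zero_right {p : ℂ} (hp : ‖p‖ < 1) (n : ℕ) : gaussBinom p n 0 = 1 := by
  have h := qFac_ne_zero hp n
  have h0 : qFac p 0 = 1 := by simp [qFac]
  simp [gaussBinom, h, h0]

theorem gaussBinom_succ_succ {p : ℂ} (hp : ‖p‖ < 1) {n j : ℕ} (hj : j ≤ n) :
    gaussBinom p (n + 1) (j + 1) = gaussBinom p n (j + 1) + p ^ (n - j) * gaussBinom p n j := by
  obtain ⟨i, rfl⟩ := Nat.exists_eq_add_of_le hj
  have hA := qFac_ne_zero hp j
  have hj1 := one_sub_mul_pow_ne_zero hp j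
  rcases i with _ | i
  · have := qFac_ne_zero hp (j + 1)
    have h0 : qFac p 0 = 1 := by simp [qFac]
    simp [gaussBinom, hA, this, h0]
  · have hB := qFac_ne_zero hp i
    have hi1 := one_sub_mul_pow_ne_zero hp i
    have e1 : j + (i + 1) + 1 - (j + 1) = i + 1 := by omega
    have e2 : j + (i + 1) - (j + 1) = i := by omega
    have e3 : j + (i + 1) - j = i + 1 := by omega
    have l1 : j + 1 ≤ j + (i + 1) + 1 := by omega
    have l2 : j + 1 ≤ j + (i + 1) := by omega
    have l3 : j ≤ j + (i + 1) := by omega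
    simp only [gaussBinom, l1, l2, l3, if_true, e1, e2, e3, qFac_succ p (j + (i + 1)),
      qFac_succ p j, qFac_succ p i]
    field_simp
    ring

theorem prod_one_sub_mul_sq_pow {r : ℂ} (hr : ‖r ^ 2‖ < 1) (w : ℂ) (n : ℕ) :
    ∏ k ∈ Finset.range n, (1 - w * (r ^ 2) ^ k) =
      ∑ j ∈ Finset.range (n + 1), r ^ (j * (j - 1)) * gaussBinom (r ^ 2) n j * (-w) ^ j := by
  induction n with
  | zero => simp [gaussBinom_zero_right hr]
  | succ n ih =>
    rw [Finset.prod_range_succ, ih, Finset.sum_range_succ' _ (n + 1), gaussBinom_zero_right hr]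
    have key : ∀ j ∈ Finset.range (n + 1),
        r ^ ((j + 1) * (j + 1 - 1)) * gaussBinom (r ^ 2) (n + 1) (j + 1) * (-w) ^ (j + 1) =
        r ^ ((j + 1) * (j + 1 - 1)) * gaussBinom (r ^ 2) n (j + 1) * (-w) ^ (j + 1) +
        -w * (r ^ 2) ^ n * (r ^ (j * (j - 1)) * gaussBinom (r ^ 2) n j * (-w) ^ j) := by
      intro j hj
      have hjn : j ≤ n := Nat.lt_succ_iff.1 (Finset.mem_range.1 hj)
      have e : r ^ ((j + 1) * (j + 1 - 1)) * (r ^ 2) ^ (n - j) =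
          (r ^ 2) ^ n * r ^ (j * (j - 1)) := by
        rw [← pow_mul, ← pow_mul, ← pow_add, ← pow_add]
        congr 1
        obtain ⟨i, rfl⟩ := Nat.exists_eq_add_of_le hjn
        rcases j with _ | j
        · simp
        · simp only [Nat.add_sub_cancel, Nat.add_sub_cancel_left]; ring
      rw [gaussBinom_succ_succ hr hjn, pow_succ (-w)]
      linear_combination (gaussBinom (r ^ 2) n j * (-w) ^ j * (-w)) * e
    rw [Finset.sum_congr rfl key, Finset.sum_add_distrib, ← Finset.mul_sum]
    have h0 : ∑ j ∈ Finset.range (n + 1), r ^ (j * (j - 1)) * gaussBinom (r ^ 2) n j * (-w) ^ j =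
        ∑ j ∈ Finset.range (n + 1),
          r ^ ((j + 1) * (j + 1 - 1)) * gaussBinom (r ^ 2) n (j + 1) * (-w) ^ (j + 1) + 1 := by
      have h1 := Finset.sum_range_succ
        (fun j => r ^ (j * (j - 1)) * gaussBinom (r ^ 2) n j * (-w) ^ j) (n + 1)
      rw [Finset.sum_range_succ'] at h1
      have h2 : gaussBinom (r ^ 2) n (n + 1) = 0 := by simp [gaussBinom]
      rw [h2, gaussBinom_zero_right hr] at h1
      simpa using h1.symm
    simp only [zero_mul, pow_zero, mul_one]
    linear_combination h0

theorem summable_norm_thetaSeries {r z : ℂ} (hr0 : r ≠ 0) (hr : ‖r‖ < 1) (hz : z ≠ 0) :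
    Summable fun n : ℤ => ‖r ^ (n * (n - 1)) * z ^ n‖ := by
  have main : ∀ (w : ℂ) (c : ℤ), w ≠ 0 →
      Summable fun n : ℕ => ‖r ^ ((n : ℤ) * (n + c)) * w ^ (n : ℤ)‖ := by
    intro w c hw
    refine summable_of_ratio_test_tendsto_lt_one zero_lt_one
      (Eventually.of_forall fun n => norm_ne_zero_iff.2
        (mul_ne_zero (zpow_ne_zero _ hr0) (zpow_ne_zero _ hw))) ?_
    have hlim : Tendsto (fun n : ℕ => (‖r‖ ^ 2) ^ n * (‖r‖ ^ (1 + c) * ‖w‖)) atTop (𝓝 0) := by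
      have := (tendsto_pow_atTop_nhds_zero_of_lt_one (sq_nonneg ‖r‖)
        (pow_lt_one₀ (norm_nonneg r) hr two_ne_zero)).mul_const (‖r‖ ^ (1 + c) * ‖w‖)
      simpa using this
    refine hlim.congr fun n => ?_
    have hr1 : ‖r‖ ≠ 0 := norm_ne_zero_iff.2 hr0
    have hw1 : ‖w‖ ≠ 0 := norm_ne_zero_iff.2 hw
    have e : ((n + 1 : ℕ) : ℤ) * ((n + 1 : ℕ) + c) = (n : ℤ) * (n + c) + 2 * n + (1 + c) := by
      push_cast; ring
    rw [norm_norm, norm_norm, e]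
    simp only [norm_mul, norm_zpow]
    rw [zpow_add₀ hr1 _ (1 + c), zpow_add₀ hr1 _ (2 * (n : ℤ)), zpow_mul ‖r‖ 2,
      Nat.cast_succ, zpow_add₀ hw1]
    have h1 := zpow_ne_zero ((n : ℤ) * (n + c)) hr1
    have h2 := zpow_ne_zero (n : ℤ) hw1
    field_simp
    simp only [zpow_natCast]
  refine Summable.of_nat_of_neg ?_ ?_
  · simpa [sub_eq_add_neg] using main z (-1) hz
  · refine (main z⁻¹ 1 (inv_ne_zero hz)).congr fun n => ?_
    congr 2
    · congr 1; ring
    · rw [inv_zpow, zpow_neg]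

theorem prod_range_neg_mul_div {r z : ℂ} (hz : z ≠ 0) (n : ℕ) :
    ∏ k ∈ Finset.range n, (-(r ^ 2 * (r ^ 2) ^ k) / z) = r ^ (n * (n + 1)) * ((-z) ^ n)⁻¹ := by
  induction n with
  | zero => simp
  | succ n ih =>
    have hz' : -z ≠ 0 := neg_ne_zero.2 hz
    have e : (n + 1) * (n + 1 + 1) = n * (n + 1) + 2 * (n + 1) := by ring
    rw [Finset.prod_range_succ, ih, e, pow_add r, pow_mul r 2, pow_succ (-z), mul_inv, inv_neg]
    field_simp
    ring

theorem prod_range_one_sub_div_pow {p z : ℂ} (hp : p ≠ 0) (hz : z ≠ 0) (n : ℕ) :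
    (∏ k ∈ Finset.range (2 * n), (1 - z / p ^ n * p ^ k)) *
        ∏ k ∈ Finset.range n, (-(p * p ^ k) / z) =
      (∏ k ∈ Finset.range n, (1 - z * p ^ k)) * ∏ k ∈ Finset.range n, (1 - p / z * p ^ k) := by
  rw [two_mul, Finset.prod_range_add, ← Finset.prod_range_reflect, mul_right_comm,
    ← Finset.prod_mul_distrib, mul_comm]
  congr 1
  · refine Finset.prod_congr rfl fun k _ => ?_
    rw [pow_add]
    field_simp
  · refine Finset.prod_congr rfl fun k hk => ?_
    obtain ⟨i, rfl⟩ := Nat.exists_eq_add_of_lt (Finset.mem_range.1 hk)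
    have e : k + i + 1 - 1 - k = i := by omega
    rw [e, show k + i + 1 = k + 1 + i by ring, pow_add, pow_succ]
    field_simp
    ring

/-- The coefficients in the finite form of the Jacobi triple product. -/
noncomputable def finiteThetaTerm (r z : ℂ) (n : ℕ) (i : ℤ) : ℂ :=
  if -(n : ℤ) ≤ i then
    gaussBinom (r ^ 2) (2 * n) (n + i).toNat * (r ^ (i * (i - 1)) * (-z) ^ i)
  else 0

theorem hasSum_finiteThetaTerm {r z : ℂ} (hr0 : r ≠ 0) (hr : ‖r ^ 2‖ < 1) (hz : z ≠ 0) (n : ℕ) :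
    HasSum (finiteThetaTerm r z n)
      ((∏ k ∈ Finset.range n, (1 - z * (r ^ 2) ^ k)) *
        ∏ k ∈ Finset.range n, (1 - r ^ 2 / z * (r ^ 2) ^ k)) := by
  have hinj : Function.Injective fun j : ℕ => (j : ℤ) - n := fun a b h => by
    simpa using h
  rw [← hinj.hasSum_iff]
  · have hval : ∀ j : ℕ, (finiteThetaTerm r z n ∘ fun j : ℕ => (j : ℤ) - n) j =
        r ^ (j * (j - 1)) * gaussBinom (r ^ 2) (2 * n) j * (-(z / (r ^ 2) ^ n)) ^ j *
          (r ^ (n * (n + 1)) * ((-z) ^ n)⁻¹) := by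
      intro j
      have hz' : -z ≠ 0 := neg_ne_zero.2 hz
      have hle : -(n : ℤ) ≤ (j : ℤ) - n := by omega
      have hnat : ((n : ℤ) + ((j : ℤ) - n)).toNat = j := by omega
      simp only [Function.comp_apply, finiteThetaTerm, hle, if_true, hnat]
      have e1 : ((j * (j - 1) : ℕ) : ℤ) = (j : ℤ) * (j - 1) := by
        rcases j with _ | j
        · simp
        · push_cast; simp
      have e2 : r ^ (((j : ℤ) - n) * ((j : ℤ) - n - 1)) * ((r ^ 2) ^ n) ^ j =
          r ^ (j * (j - 1)) * r ^ (n * (n + 1)) := by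
        rw [← pow_mul, ← pow_mul, ← zpow_natCast r (2 * (n * j)), ← zpow_natCast r (j * (j - 1)),
          ← zpow_natCast r (n * (n + 1)), ← zpow_add₀ hr0, ← zpow_add₀ hr0, e1]
        congr 1
        push_cast
        ring
      have hrn : ((r ^ 2) ^ n) ^ j ≠ 0 := by positivity
      rw [zpow_sub₀ hz', zpow_natCast, zpow_natCast, ← neg_div, div_pow, div_eq_mul_inv,
        div_eq_mul_inv]
      rw [← eq_div_iff hrn] at e2
      rw [e2]
      ring
    rw [funext hval, ← prod_range_one_sub_div_pow (pow_ne_zero 2 hr0) hz,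
      prod_one_sub_mul_sq_pow hr, prod_range_neg_mul_div hz, Finset.sum_mul]
    refine hasSum_sum_of_ne_finset_zero fun j hj => ?_
    have : ¬ j ≤ 2 * n := fun h => hj (Finset.mem_range.2 (by omega))
    simp [gaussBinom, this]
  · intro i hi
    refine if_neg fun h => hi ⟨(n + i).toNat, ?_⟩
    simp only
    omega

theorem exists_norm_gaussBinom_le {p : ℂ} (hp : ‖p‖ < 1) :
    ∃ C, ∀ n j, ‖gaussBinom p n j‖ ≤ C := by
  obtain ⟨A, hA⟩ := (tendsto_qp hp p).norm.bddAbove_range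
  obtain ⟨B, hB⟩ := ((tendsto_qp hp p).inv₀ (qp_ne_zero hp hp)).norm.bddAbove_range
  have hA' : ∀ n, ‖qFac p n‖ ≤ A := fun n => hA ⟨n, rfl⟩
  have hB' : ∀ n, ‖(qFac p n)⁻¹‖ ≤ B := fun n => hB ⟨n, rfl⟩
  have hA0 : 0 ≤ A := (norm_nonneg _).trans (hA' 0)
  have hB0 : 0 ≤ B := (norm_nonneg _).trans (hB' 0)
  refine ⟨A * (B * B), fun n j => ?_⟩
  unfold gaussBinom
  split_ifs
  · rw [div_eq_mul_inv, mul_inv, norm_mul, norm_mul]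
    exact mul_le_mul (hA' n) (mul_le_mul (hB' _) (hB' _) (norm_nonneg _) hB0) (by positivity) hA0
  · simpa using by positivity

theorem tendsto_gaussBinom {p : ℂ} (hp : ‖p‖ < 1) (i : ℤ) :
    Tendsto (fun n : ℕ => gaussBinom p (2 * n) (n + i).toNat) atTop (𝓝 (qp p p)⁻¹) := by
  have hE := qp_ne_zero hp hp
  have hq : Tendsto (qFac p) atTop (𝓝 (qp p p)) := tendsto_qp hp p
  have ht : ∀ c : ℤ, Tendsto (fun n : ℕ => ((n : ℤ) + c).toNat) atTop atTop := fun c =>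
    tendsto_atTop.2 fun b => (eventually_ge_atTop (b + c.natAbs)).mono fun n hn => by omega
  have h2 : Tendsto (fun n : ℕ => 2 * n) atTop atTop := tendsto_id.const_mul_atTop' two_pos
  have h := (hq.comp h2).div ((hq.comp (ht i)).mul (hq.comp (ht (-i)))) (mul_ne_zero hE hE)
  rw [div_mul_cancel_left₀ hE] at h
  refine h.congr' ((eventually_ge_atTop i.natAbs).mono fun n hn => ?_)
  have h1 : ((n : ℤ) + i).toNat ≤ 2 * n := by omega
  have h3 : 2 * n - ((n : ℤ) + i).toNat = ((n : ℤ) + -i).toNat := by omega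
  simp [gaussBinom, h1, h3]

/-- The Jacobi triple product identity. -/
theorem thetaSeries_neg {r z : ℂ} (hr0 : r ≠ 0) (hr : ‖r‖ < 1) (hz : z ≠ 0) :
    thetaSeries r (-z) = qp (r ^ 2) (r ^ 2) * (qp z (r ^ 2) * qp (r ^ 2 / z) (r ^ 2)) := by
  have hp : ‖r ^ 2‖ < 1 := by
    rw [norm_pow]; exact pow_lt_one₀ (norm_nonneg _) hr two_ne_zero
  obtain ⟨C, hC⟩ := exists_norm_gaussBinom_le hp
  have hC0 : 0 ≤ C := (norm_nonneg _).trans (hC 0 0)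
  have hlim := tendsto_tsum_of_dominated_convergence (𝓕 := atTop) (f := finiteThetaTerm r z)
    (g := fun i => (qp (r ^ 2) (r ^ 2))⁻¹ * (r ^ (i * (i - 1)) * (-z) ^ i))
    ((summable_norm_thetaSeries hr0 hr (neg_ne_zero.2 hz)).mul_left C) ?_ ?_
  · rw [tsum_mul_left] at hlim
    have h := tendsto_nhds_unique hlim
      (((tendsto_qp hp z).mul (tendsto_qp hp (r ^ 2 / z))).congr fun n =>
        (hasSum_finiteThetaTerm hr0 hp hz n).tsum_eq.symm)
    rw [← h, thetaSeries, mul_inv_cancel_left₀ (qp_ne_zero hp hp)]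
  · intro i
    refine ((tendsto_gaussBinom hp i).mul_const _).congr' ?_
    refine (eventually_ge_atTop i.natAbs).mono fun n hn => ?_
    have : -(n : ℤ) ≤ i := by omega
    simp [finiteThetaTerm, this]
  · refine Eventually.of_forall fun n i => ?_
    unfold finiteThetaTerm
    split_ifs
    · rw [norm_mul]
      exact mul_le_mul_of_nonneg_right (hC _ _) (norm_nonneg _)
    · rw [norm_zero]; positivity

/-- Sums and differences identify two copies of `ℤ × ℤ` with the two parity classes. -/
theorem bijective_sum_sub :
    Function.Bijective (Sum.elim (fun k : ℤ × ℤ => (k.1 + k.2, k.1 - k.2))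
      (fun k : ℤ × ℤ => (k.1 + k.2, k.1 - k.2 + 1))) := by
  constructor
  · rintro (⟨a, b⟩ | ⟨a, b⟩) (⟨c, d⟩ | ⟨c, d⟩) h <;>
      simp only [Sum.elim_inl, Sum.elim_inr, Prod.mk.injEq, Sum.inl.injEq, Sum.inr.injEq,
        reduceCtorEq] at h ⊢ <;> omega
  · rintro ⟨m, n⟩
    rcases Int.even_or_odd' (m + n) with ⟨k, hk | hk⟩
    · exact ⟨Sum.inl (k, m - k), by simp only [Sum.elim_inl, Prod.mk.injEq]; omega⟩
    · exact ⟨Sum.inr (k, m - k), by simp only [Sum.elim_inr, Prod.mk.injEq]; omega⟩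

theorem thetaSeries_mul_thetaSeries {r x y : ℂ} (hr0 : r ≠ 0) (hr : ‖r‖ < 1) (hx : x ≠ 0)
    (hy : y ≠ 0) :
    thetaSeries r (x * y) * thetaSeries r (x / y) =
      thetaSeries (r ^ 2) (x ^ 2) * thetaSeries (r ^ 2) (r ^ 2 * y ^ 2) +
        x / y * (thetaSeries (r ^ 2) (r ^ 2 * x ^ 2) * thetaSeries (r ^ 2) (y ^ 2)) := by
  have hp0 : r ^ 2 ≠ 0 := pow_ne_zero 2 hr0
  have hp : ‖r ^ 2‖ < 1 := by
    rw [norm_pow]; exact pow_lt_one₀ (norm_nonneg _) hr two_ne_zero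
  have hx2 : x ^ 2 ≠ 0 := pow_ne_zero 2 hx
  have hy2 : y ^ 2 ≠ 0 := pow_ne_zero 2 hy
  have s1 := summable_norm_thetaSeries hr0 hr (mul_ne_zero hx hy)
  have s2 := summable_norm_thetaSeries hr0 hr (div_ne_zero hx hy)
  have s := summable_mul_of_summable_norm s1 s2
  let e := Equiv.ofBijective _ bijective_sum_sub
  have se := e.summable_iff.2 s
  unfold thetaSeries
  rw [tsum_mul_tsum_of_summable_norm s1 s2, ← e.tsum_eq]
  refine (Summable.tsum_sum (se.comp_injective Sum.inl_injective)
      (se.comp_injective Sum.inr_injective)).trans ?_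
  rw [tsum_mul_tsum_of_summable_norm (summable_norm_thetaSeries hp0 hp hx2)
      (summable_norm_thetaSeries hp0 hp (mul_ne_zero hp0 hy2)),
    tsum_mul_tsum_of_summable_norm
      (summable_norm_thetaSeries hp0 hp (mul_ne_zero hp0 hx2))
      (summable_norm_thetaSeries hp0 hp hy2), ← tsum_mul_left]
  have zsq : ∀ (w : ℂ) (m : ℤ), (w ^ 2) ^ m = w ^ (2 * m) := fun w m => by
    rw [zpow_mul, zpow_ofNat]
  congr 1
  · refine tsum_congr fun k => ?_
    simp only [Function.comp_apply, e, Equiv.ofBijective_apply, Sum.elim_inl,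
      zsq, mul_zpow, div_zpow]
    have e1 : r ^ ((k.1 + k.2) * (k.1 + k.2 - 1)) * r ^ ((k.1 - k.2) * (k.1 - k.2 - 1)) =
        r ^ (2 * (k.1 * (k.1 - 1))) * (r ^ (2 * (k.2 * (k.2 - 1))) * r ^ (2 * k.2)) := by
      simp only [← zpow_add₀ hr0]; congr 1; ring
    have e2 : x ^ (k.1 + k.2) * x ^ (k.1 - k.2) = x ^ (2 * k.1) := by
      simp only [← zpow_add₀ hx]; congr 1; ring
    have e3 : y ^ (k.1 + k.2) * (y ^ (k.1 - k.2))⁻¹ = y ^ (2 * k.2) := by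
      simp only [← zpow_neg, ← zpow_add₀ hy]; congr 1; ring
    rw [← e2, ← e3]
    linear_combination (x ^ (k.1 + k.2) * x ^ (k.1 - k.2) *
      (y ^ (k.1 + k.2) * (y ^ (k.1 - k.2))⁻¹)) * e1
  · refine tsum_congr fun k => ?_
    simp only [Function.comp_apply, e, Equiv.ofBijective_apply, Sum.elim_inr,
      zsq, mul_zpow, div_zpow]
    have e1 : r ^ ((k.1 + k.2) * (k.1 + k.2 - 1)) *
        r ^ ((k.1 - k.2 + 1) * (k.1 - k.2 + 1 - 1)) =
        r ^ (2 * (k.1 * (k.1 - 1))) * r ^ (2 * k.1) * r ^ (2 * (k.2 * (k.2 - 1))) := by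
      simp only [← zpow_add₀ hr0]; congr 1; ring
    have e2 : x ^ (k.1 + k.2) * x ^ (k.1 - k.2 + 1) = x ^ (2 * k.1) * x := by
      rw [← zpow_add₀ hx, ← zpow_add_one₀ hx]; congr 1; ring
    have e3 : y ^ (k.1 + k.2) * (y ^ (k.1 - k.2 + 1))⁻¹ = y ^ (2 * k.2) * y⁻¹ := by
      rw [← zpow_neg, ← zpow_add₀ hy, ← zpow_sub_one₀ hy]; congr 1; ring
    linear_combination (x ^ (k.1 + k.2) * x ^ (k.1 - k.2 + 1) *
      (y ^ (k.1 + k.2) * (y ^ (k.1 - k.2 + 1))⁻¹)) * e1 +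
      r ^ (2 * (k.1 * (k.1 - 1))) * r ^ (2 * k.1) * r ^ (2 * (k.2 * (k.2 - 1))) *
      (y ^ (k.1 + k.2) * (y ^ (k.1 - k.2 + 1))⁻¹) * e2 +
      r ^ (2 * (k.1 * (k.1 - 1))) * r ^ (2 * k.1) * r ^ (2 * (k.2 * (k.2 - 1))) *
      (x ^ (2 * k.1) * x) * e3

/-- The three-term relation of Weierstrass for theta series. -/
theorem thetaSeries_three_term {r x y u v : ℂ} (hr0 : r ≠ 0) (hr : ‖r‖ < 1) (hx : x ≠ 0)
    (hy : y ≠ 0) (hu : u ≠ 0) (hv : v ≠ 0) :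
    y * (thetaSeries r (-(x * y)) * thetaSeries r (-(x / y))) *
        (thetaSeries r (-(u * v)) * thetaSeries r (-(u / v))) -
      u * (thetaSeries r (-(x * u)) * thetaSeries r (-(x / u))) *
        (thetaSeries r (-(y * v)) * thetaSeries r (-(y / v))) +
      u * (thetaSeries r (-(x * v)) * thetaSeries r (-(x / v))) *
        (thetaSeries r (-(y * u)) * thetaSeries r (-(y / u))) = 0 := by
  have key : ∀ {a b : ℂ}, a ≠ 0 → b ≠ 0 →
      thetaSeries r (-(a * b)) * thetaSeries r (-(a / b)) =
        thetaSeries (r ^ 2) (a ^ 2) * thetaSeries (r ^ 2) (r ^ 2 * b ^ 2) -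
          a / b * (thetaSeries (r ^ 2) (r ^ 2 * a ^ 2) * thetaSeries (r ^ 2) (b ^ 2)) := by
    intro a b ha hb
    have h := thetaSeries_mul_thetaSeries hr0 hr (neg_ne_zero.2 ha) hb
    rw [neg_mul, neg_div, neg_sq] at h
    rw [h]
    ring
  rw [key hx hy, key hu hv, key hx hu, key hy hv, key hx hv, key hy hu]
  field_simp
  ring

theorem thetaSeries_neg_pow {q : ℂ} (hq0 : q ≠ 0) (hq : ‖q‖ < 1) {m n : ℕ} (hmn : m + n = 10) :
    thetaSeries (q ^ 5) (-q ^ m) =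
      E (q ^ 10) * (qp (q ^ m) (q ^ 10) * qp (q ^ n) (q ^ 10)) := by
  have hr : ‖q ^ 5‖ < 1 := by
    rw [norm_pow]; exact pow_lt_one₀ (norm_nonneg _) hq (by norm_num)
  have e : q ^ 10 / q ^ m = q ^ n := by
    rw [← hmn, pow_add, mul_div_cancel_left₀ _ (pow_ne_zero m hq0)]
  rw [thetaSeries_neg (pow_ne_zero 5 hq0) hr (pow_ne_zero m hq0), ← pow_mul, e, E_eq_qp]

theorem stmt_6 : ∀ q : ℂ, ‖q‖ < 1 →
    R (q ^ 2) / R q ^ 2 - R q ^ 2 / R (q ^ 2)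
      = 4 * q * E q * E (q ^ 10) ^ 5 / (E (q ^ 2) * E (q ^ 5) ^ 5) := by
  intro q hq
  rcases eq_or_ne q 0 with rfl | hq0
  · simp [R, qp_ne_zero]
  have hpow : ∀ m : ℕ, m ≠ 0 → ‖q ^ m‖ < 1 := fun m hm => by
    rw [norm_pow]; exact pow_lt_one₀ (norm_nonneg _) hq hm
  have hr := hpow 5 (by norm_num)
  have hr0 : q ^ 5 ≠ 0 := pow_ne_zero 5 hq0
  have hne : ∀ m : ℕ, m ≠ 0 → qp (q ^ m) (q ^ 10) ≠ 0 := fun m hm =>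
    qp_ne_zero (hpow 10 (by norm_num)) (hpow m hm)
  have hEt := E_eq_qp (q ^ 10)
  have hT := fun m n h => thetaSeries_neg_pow (m := m) (n := n) hq0 hq h
  have T1 := hT 1 9 rfl
  have T2 := hT 2 8 rfl
  have T3 := hT 3 7 rfl
  have T4 := hT 4 6 rfl
  have T5 := hT 5 5 rfl
  have T6 := hT 6 4 rfl
  have T7 := hT 7 3 rfl
  have T8 := hT 8 2 rfl
  have w1 := thetaSeries_three_term hr0 hr (pow_ne_zero 5 hq0) (pow_ne_zero 3 hq0)
    (pow_ne_zero 1 hq0) (pow_ne_zero 0 hq0)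
  have w2 := thetaSeries_three_term hr0 hr (pow_ne_zero 4 hq0) (pow_ne_zero 3 hq0)
    (pow_ne_zero 2 hq0) (pow_ne_zero 0 hq0)
  have hd : ∀ m n : ℕ, n ≤ m → q ^ m / q ^ n = q ^ (m - n) := fun m n h => by
    rw [pow_sub₀ q hq0 h, div_eq_mul_inv]
  rw [hd 5 3 (by norm_num), hd 1 0 (by norm_num), hd 5 1 (by norm_num), hd 3 0 (by norm_num),
    hd 5 0 (by norm_num), hd 3 1 (by norm_num)] at w1
  rw [hd 4 3 (by norm_num), hd 2 0 (by norm_num), hd 4 2 (by norm_num), hd 3 0 (by norm_num),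
    hd 4 0 (by norm_num), hd 3 2 (by norm_num)] at w2
  simp only [← pow_add, Nat.reduceAdd, Nat.reduceSub, T1, T2, T3, T4, T5, T6, T7, T8] at w1 w2
  have hs : ∀ m : ℕ, qp (q ^ m) (q ^ 5) = qp (q ^ m) (q ^ 10) * qp (q ^ (m + 5)) (q ^ 10) := by
    intro m
    rw [qp_eq_prod hr (q ^ m) Nat.two_pos, Finset.prod_range_succ, Finset.prod_range_one]
    simp only [pow_zero, pow_one, mul_one, ← pow_mul, ← pow_add, Nat.reduceMul]
  have hs1 := hs 1
  rw [pow_one] at hs1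
  have hE1 : E q = ∏ i ∈ Finset.range 10, qp (q ^ (i + 1)) (q ^ 10) := by
    rw [E_eq_qp, qp_eq_prod hq q (by norm_num : 0 < 10)]
    simp only [pow_succ']
  have hE2 : E (q ^ 2) = ∏ i ∈ Finset.range 5, qp (q ^ (2 * i + 2)) (q ^ 10) := by
    rw [E_eq_qp, qp_eq_prod (hpow 2 two_ne_zero) (q ^ 2) (by norm_num : 0 < 5)]
    simp only [← pow_mul, ← pow_add, Nat.reduceMul, add_comm]
  have hE5 : E (q ^ 5) = qp (q ^ 5) (q ^ 10) * qp (q ^ 10) (q ^ 10) := by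
    rw [E_eq_qp, hs 5]
  have hR1 : R q = qp (q ^ 1) (q ^ 10) * qp (q ^ 6) (q ^ 10) *
      (qp (q ^ 4) (q ^ 10) * qp (q ^ 9) (q ^ 10)) /
      (qp (q ^ 2) (q ^ 10) * qp (q ^ 7) (q ^ 10) *
        (qp (q ^ 3) (q ^ 10) * qp (q ^ 8) (q ^ 10))) := by
    rw [R, hs1, hs 2, hs 3, hs 4, pow_one]
  have hR2 : R (q ^ 2) = qp (q ^ 2) (q ^ 10) * qp (q ^ 8) (q ^ 10) /
      (qp (q ^ 4) (q ^ 10) * qp (q ^ 6) (q ^ 10)) := by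
    simp only [R, ← pow_mul, Nat.reduceMul]
  simp only [Finset.prod_range_succ, Finset.prod_range_zero, Nat.reduceAdd, Nat.reduceMul]
    at hE1 hE2
  rw [hR1, hR2, hE1, hE2, hE5, hEt]
  rw [hEt] at w1 w2
  have n1 := hne 1 (by norm_num)
  have n2 := hne 2 (by norm_num)
  have n3 := hne 3 (by norm_num)
  have n4 := hne 4 (by norm_num)
  have n5 := hne 5 (by norm_num)
  have n6 := hne 6 (by norm_num)
  have n7 := hne 7 (by norm_num)
  have n8 := hne 8 (by norm_num)
  have n9 := hne 9 (by norm_num)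
  have n10 := hne 10 (by norm_num)
  generalize qp (q ^ 1) (q ^ 10) = t1 at *
  generalize qp (q ^ 2) (q ^ 10) = t2 at *
  generalize qp (q ^ 3) (q ^ 10) = t3 at *
  generalize qp (q ^ 4) (q ^ 10) = t4 at *
  generalize qp (q ^ 5) (q ^ 10) = t5 at *
  generalize qp (q ^ 6) (q ^ 10) = t6 at *
  generalize qp (q ^ 7) (q ^ 10) = t7 at *
  generalize qp (q ^ 8) (q ^ 10) = t8 at *
  generalize qp (q ^ 9) (q ^ 10) = t9 at *
  generalize qp (q ^ 10) (q ^ 10) = t10 at *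
  clear hT T1 T2 T3 T4 T5 T6 T7 T8 hs hs1 hE1 hE2 hE5 hR1 hR2 hEt hne hd
  obtain ⟨a, ha⟩ : ∃ a, a = t1 * t9 := ⟨_, rfl⟩
  obtain ⟨b, hb⟩ : ∃ b, b = t2 * t8 := ⟨_, rfl⟩
  obtain ⟨c, hc⟩ : ∃ c, c = t3 * t7 := ⟨_, rfl⟩
  obtain ⟨d, hd⟩ : ∃ d, d = t4 * t6 := ⟨_, rfl⟩
  have ha0 : a ≠ 0 := ha ▸ mul_ne_zero n1 n9
  have hb0 : b ≠ 0 := hb ▸ mul_ne_zero n2 n8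
  have hc0 : c ≠ 0 := hc ▸ mul_ne_zero n3 n7
  have hd0 : d ≠ 0 := hd ▸ mul_ne_zero n4 n6
  have W1 : c ^ 2 * d ^ 2 - q ^ 2 * a ^ 2 * b ^ 2 = b * d * t5 ^ 4 := by
    apply mul_left_cancel₀ (mul_ne_zero hq0 (pow_ne_zero 4 n10))
    subst ha hb hc hd
    linear_combination -w1
  have W2 : b * c ^ 2 * d - q * a * b ^ 2 * c = a * d ^ 2 * t5 ^ 2 := by
    apply mul_left_cancel₀ (mul_ne_zero (pow_ne_zero 2 hq0) (pow_ne_zero 4 n10))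
    subst ha hb hc hd
    linear_combination -w2
  have W3 : a * d * (c * d + q * a * b) = b ^ 2 * c * t5 ^ 2 := by
    apply mul_left_cancel₀ (mul_ne_zero hd0 (pow_ne_zero 2 n5))
    linear_combination (b * c) * W1 - (c * d + q * a * b) * W2
  have main : (b ^ 6 * c ^ 4 - a ^ 4 * d ^ 6) * t5 ^ 4 = 4 * q * a ^ 3 * b ^ 3 * c ^ 3 * d ^ 3 := by
    have h3 := congrArg (· ^ 2) W3
    have h2 := congrArg (· ^ 2) W2
    beta_reduce at h2 h3
    linear_combination (-b ^ 2 * c ^ 2) * h3 + (a ^ 2 * d ^ 2) * h2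
  have l1 : t1 * t6 * (t4 * t9) / (t2 * t7 * (t3 * t8)) = a * d / (b * c) := by
    subst ha hb hc hd; congr 1 <;> ring
  have l2 : 4 * q * (1 * t1 * t2 * t3 * t4 * t5 * t6 * t7 * t8 * t9 * t10) * t10 ^ 5 /
      (1 * t2 * t4 * t6 * t8 * t10 * (t5 * t10) ^ 5) = 4 * q * a * c / t5 ^ 4 := by
    subst ha hc; field_simp
  rw [l1, l2, ← hb, ← hd]
  field_simp
  linear_combination main
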